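/- arXiv:2504.04659 — 2 statements merged into one kernel-verified Lean document; each statement's English description precedes it below -/
import Mathlib

section
/- Let H_1 and H_2 be search-cost distributions on the same interval [0, c̄], each satisfying Assumption 1, and suppose H_2 first-order stochastically dominates H_1, i.e. H_2(c) ≤ H_1(c) for all c ∈ [0, c̄]. Then s*(H_2) ≤ s*(H_1) and a^M(H_2) ≤ a^M(H_1). -/
open MeasureTheory Set Function Filter

noncomputable section

namespace CompSearch

def mean (F : ℝ → ℝ) : ℝ := ∫ t in (0:ℝ)..1, (1 - F t)

def cInt (G : ℝ → ℝ) (x : ℝ) : ℝ := ∫ t in x..(1:ℝ), (1 - G t)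

/-- The prior F with density f. -/
structure IsPrior (F f : ℝ → ℝ) : Prop where
  zero : ∀ x ≤ (0:ℝ), F x = 0
  one : ∀ x ≥ (1:ℝ), F x = 1
  smooth : ContDiffOn ℝ 2 F (Icc 0 1)
  deriv : ∀ x ∈ Icc (0:ℝ) 1, HasDerivWithinAt F (f x) (Icc 0 1) x
  fpos : ∀ x ∈ Icc (0:ℝ) 1, 0 < f x
  fcont : ContinuousOn f (Icc 0 1)

/-- A search-cost distribution given as a plain c.d.f. H with density h on [0, c̄]. -/
structure IsCostD (H h : ℝ → ℝ) (cbar : ℝ) : Prop where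
  cbar_pos : 0 < cbar
  zero : H 0 = 0
  one : H cbar = 1
  smooth : ContDiffOn ℝ 2 H (Icc 0 cbar)
  deriv : ∀ c ∈ Icc (0:ℝ) cbar, HasDerivWithinAt H (h c) (Icc 0 cbar) c
  hpos : ∀ c ∈ Icc (0:ℝ) cbar, 0 < h c

/-- Average density S(c) = H(c)/c, S(0) = h(0). -/
def Sfun (H h : ℝ → ℝ) (c : ℝ) : ℝ := if c = 0 then h 0 else H c / c

/-- minimal average density s*(H) = min_{c ∈ [0,c̄]} S(c). -/
def sStar (H h : ℝ → ℝ) (cbar : ℝ) : ℝ := sInf (Sfun H h '' Icc 0 cbar)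

/-- Assumption 1: the global minimum of S on [0,c̄] is attained at some c^M < c̄. -/
def Assumption1 (H h : ℝ → ℝ) (cbar : ℝ) : Prop :=
  ∃ cM ∈ Ico (0:ℝ) cbar, ∀ c ∈ Icc (0:ℝ) cbar, Sfun H h cM ≤ Sfun H h c

/-- Inverse of c_F on [0,1]. -/
def cFinv (F : ℝ → ℝ) (y : ℝ) : ℝ := Function.invFunOn (cInt F) (Icc 0 1) y

/-- The maximally informative threshold a^M(H). -/
def aM (F H h : ℝ → ℝ) (cbar : ℝ) : ℝ :=
  if sStar H h cbar ≤ 1 / mean F then 0 else cFinv F (1 / sStar H h cbar)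

/-- H₂ is a mean-preserving spread of H₁ on [0, c̄]. -/
def MPSpread (H1 H2 : ℝ → ℝ) (cbar : ℝ) : Prop :=
  (∀ x ∈ Icc (0:ℝ) cbar, (∫ t in (0:ℝ)..x, H1 t) ≤ ∫ t in (0:ℝ)..x, H2 t) ∧
  (∫ t in (0:ℝ)..cbar, H1 t) = ∫ t in (0:ℝ)..cbar, H2 t

/-- The density has at most finitely many local extrema: there is a finite
partition of [0,c̄] on each piece of which it is monotone. -/
def FinitelyPiecewiseMono (h : ℝ → ℝ) (cbar : ℝ) : Prop :=
  ∃ (K : ℕ) (x : ℕ → ℝ), 0 < K ∧ x 0 = 0 ∧ x K = cbar ∧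
    (∀ i < K, x i ≤ x (i + 1)) ∧
    ∀ i < K, MonotoneOn h (Icc (x i) (x (i + 1))) ∨ AntitoneOn h (Icc (x i) (x (i + 1)))


theorem IsPrior.monotoneOn {F f : ℝ → ℝ} (hF : IsPrior F f) : MonotoneOn F (Icc 0 1) := by
  refine monotoneOn_of_hasDerivWithinAt_nonneg (f' := f) (convex_Icc 0 1)
    hF.smooth.continuousOn (fun x hx => ?_) (fun x hx => ?_)
  · exact (hF.deriv x (interior_subset hx)).mono interior_subset
  · exact (hF.fpos x (interior_subset hx)).le

theorem IsPrior.le_one {F f : ℝ → ℝ} (hF : IsPrior F f) {x : ℝ} (hx : x ∈ Icc (0 : ℝ) 1) :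
    F x ≤ 1 :=
  hF.one 1 le_rfl ▸ hF.monotoneOn hx (right_mem_Icc.2 zero_le_one) hx.2

theorem IsPrior.intervalIntegrable_one_sub {F f : ℝ → ℝ} (hF : IsPrior F f) {x y : ℝ}
    (hx : x ∈ Icc (0 : ℝ) 1) (hy : y ∈ Icc (0 : ℝ) 1) :
    IntervalIntegrable (fun t => 1 - F t) volume x y :=
  ((continuousOn_const.sub hF.smooth.continuousOn).mono
    (ordConnected_Icc.uIcc_subset hx hy)).intervalIntegrable

theorem IsPrior.cInt_antitoneOn {F f : ℝ → ℝ} (hF : IsPrior F f) :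
    AntitoneOn (cInt F) (Icc 0 1) := by
  intro x hx y hy hxy
  have hone : (1 : ℝ) ∈ Icc (0 : ℝ) 1 := right_mem_Icc.2 zero_le_one
  have hadd := intervalIntegral.integral_add_adjacent_intervals
    (hF.intervalIntegrable_one_sub hx hy) (hF.intervalIntegrable_one_sub hy hone)
  have hnonneg : 0 ≤ ∫ t in x..y, (1 - F t) :=
    intervalIntegral.integral_nonneg hxy fun t ht =>
      sub_nonneg.2 (hF.le_one ⟨hx.1.trans ht.1, ht.2.trans hy.2⟩)
  unfold cInt
  linarith

theorem IsPrior.cInt_continuousOn {F f : ℝ → ℝ} (hF : IsPrior F f) :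
    ContinuousOn (cInt F) (Icc 0 1) := by
  have hint := hF.intervalIntegrable_one_sub (left_mem_Icc.2 zero_le_one)
    (right_mem_Icc.2 zero_le_one)
  have h := intervalIntegral.continuousOn_primitive_interval_left
    ((intervalIntegrable_iff_integrableOn_Icc_of_le zero_le_one).1 hint |>.mono_set
      (uIcc_of_le zero_le_one).subset)
  rwa [uIcc_of_le zero_le_one] at h

theorem IsPrior.mem_image_cInt {F f : ℝ → ℝ} (hF : IsPrior F f) {y : ℝ}
    (hy : y ∈ Icc 0 (mean F)) : y ∈ cInt F '' Icc 0 1 := by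
  refine intermediate_value_Icc' zero_le_one hF.cInt_continuousOn ?_
  simpa [cInt, mean] using hy

theorem IsPrior.cFinv_mem {F f : ℝ → ℝ} (hF : IsPrior F f) {y : ℝ}
    (hy : y ∈ Icc 0 (mean F)) : cFinv F y ∈ Icc (0 : ℝ) 1 :=
  invFunOn_mem (hF.mem_image_cInt hy)

theorem IsPrior.cInt_cFinv {F f : ℝ → ℝ} (hF : IsPrior F f) {y : ℝ}
    (hy : y ∈ Icc 0 (mean F)) : cInt F (cFinv F y) = y :=
  invFunOn_eq (hF.mem_image_cInt hy)

theorem IsPrior.cFinv_antitoneOn {F f : ℝ → ℝ} (hF : IsPrior F f) :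
    AntitoneOn (cFinv F) (Icc 0 (mean F)) := by
  intro x hx y hy hxy
  by_contra! hlt
  have h := hF.cInt_antitoneOn (hF.cFinv_mem hx) (hF.cFinv_mem hy) hlt.le
  rw [hF.cInt_cFinv hx, hF.cInt_cFinv hy] at h
  obtain rfl : x = y := le_antisymm hxy h
  exact lt_irrefl _ hlt

theorem sStar_le_Sfun {H h : ℝ → ℝ} {cbar c : ℝ} (hA : Assumption1 H h cbar)
    (hc : c ∈ Icc 0 cbar) : sStar H h cbar ≤ Sfun H h c := by
  obtain ⟨cM, -, hmin⟩ := hA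
  exact csInf_le ⟨_, forall_mem_image.2 hmin⟩ (mem_image_of_mem _ hc)

theorem exists_sStar_eq_Sfun {H h : ℝ → ℝ} {cbar : ℝ} (hA : Assumption1 H h cbar) :
    ∃ c ∈ Icc 0 cbar, sStar H h cbar = Sfun H h c := by
  obtain ⟨cM, hcM, hmin⟩ := hA
  have hmem : cM ∈ Icc 0 cbar := Ico_subset_Icc_self hcM
  exact ⟨cM, hmem, IsLeast.csInf_eq ⟨mem_image_of_mem _ hmem, forall_mem_image.2 hmin⟩⟩

theorem density_zero_le_of_fosd {H1 h1 H2 h2 : ℝ → ℝ} {cbar : ℝ}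
    (hH1 : IsCostD H1 h1 cbar) (hH2 : IsCostD H2 h2 cbar)
    (hfosd : ∀ c ∈ Icc (0 : ℝ) cbar, H2 c ≤ H1 c) : h2 0 ≤ h1 0 := by
  have hzero : (0 : ℝ) ∈ Icc 0 cbar := left_mem_Icc.2 hH1.cbar_pos.le
  have hslope1 := hasDerivWithinAt_iff_tendsto_slope.1 (hH1.deriv 0 hzero)
  have hslope2 := hasDerivWithinAt_iff_tendsto_slope.1 (hH2.deriv 0 hzero)
  rw [Icc_sdiff_left] at hslope1 hslope2
  have := left_nhdsWithin_Ioc_neBot hH1.cbar_pos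
  refine le_of_tendsto_of_tendsto hslope2 hslope1 ?_
  filter_upwards [self_mem_nhdsWithin] with c hc
  simp only [slope_def_field, hH1.zero, hH2.zero, sub_zero]
  exact div_le_div_of_nonneg_right (hfosd c (Ioc_subset_Icc_self hc)) hc.1.le

theorem Sfun_le_of_fosd {H1 h1 H2 h2 : ℝ → ℝ} {cbar : ℝ}
    (hH1 : IsCostD H1 h1 cbar) (hH2 : IsCostD H2 h2 cbar)
    (hfosd : ∀ c ∈ Icc (0 : ℝ) cbar, H2 c ≤ H1 c) {c : ℝ} (hc : c ∈ Icc 0 cbar) :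
    Sfun H2 h2 c ≤ Sfun H1 h1 c := by
  unfold Sfun
  split_ifs
  · exact density_zero_le_of_fosd hH1 hH2 hfosd
  · exact div_le_div_of_nonneg_right (hfosd c hc) hc.1

/-- If H₁, H₂ satisfy Assumption 1 on [0,c̄] and H₂ first-order
stochastically dominates H₁ (H₂ ≤ H₁ pointwise), then s*(H₂) ≤ s*(H₁) and
a^M(H₂) ≤ a^M(H₁). -/
theorem fosd_decreases_informativeness
    (F f : ℝ → ℝ) (hF : IsPrior F f)
    (H1 h1 H2 h2 : ℝ → ℝ) (cbar : ℝ)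
    (hH1 : IsCostD H1 h1 cbar) (hH2 : IsCostD H2 h2 cbar)
    (hcbar : cbar < mean F)
    (hA1 : Assumption1 H1 h1 cbar) (hA2 : Assumption1 H2 h2 cbar)
    (hfosd : ∀ c ∈ Icc (0:ℝ) cbar, H2 c ≤ H1 c) :
    sStar H2 h2 cbar ≤ sStar H1 h1 cbar ∧
    aM F H2 h2 cbar ≤ aM F H1 h1 cbar := by
  have hs : sStar H2 h2 cbar ≤ sStar H1 h1 cbar := by
    obtain ⟨c, hc, heq⟩ := exists_sStar_eq_Sfun hA1
    rw [heq]
    exact (sStar_le_Sfun hA2 hc).trans (Sfun_le_of_fosd hH1 hH2 hfosd hc)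
  have hmean : 0 < mean F := hH1.cbar_pos.trans hcbar
  have hinv {s : ℝ} (h : 1 / mean F < s) : 1 / s ∈ Icc 0 (mean F) := by
    have hpos : 0 < s := (one_div_pos.2 hmean).trans h
    exact ⟨(one_div_pos.2 hpos).le, ((one_div_lt hmean hpos).1 h).le⟩
  refine ⟨hs, ?_⟩
  unfold aM
  split_ifs with hle2 hle1 hle1
  · exact le_rfl
  · exact (hF.cFinv_mem (hinv (not_le.1 hle1))).1
  · exact absurd (hs.trans hle1) hle2
  · have hpos : 0 < sStar H2 h2 cbar := (one_div_pos.2 hmean).trans (not_le.1 hle2)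
    exact hF.cFinv_antitoneOn (hinv (not_le.1 hle1)) (hinv (not_le.1 hle2))
      (one_div_le_one_div_of_le hpos hs)

end CompSearch
end
end

section
/- Let H be a search-cost distribution on [0, c̄] satisfying Assumption 1 whose density h is strictly increasing on [0, p] and strictly decreasing on [p, c̄] for some p ∈ (0, c̄). Then the global minimum of S on [0, c̄] is attained at c = 0, i.e. H(c) ≥ h(0)·c for all c ∈ [0, c̄], so that s*(H) = h(0). -/
open MeasureTheory Set Function Filter

noncomputable section

namespace CompSearch

namespace IsCostD

variable {H h : ℝ → ℝ} {cbar : ℝ}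

theorem hasDerivAt (hH : IsCostD H h cbar) {c : ℝ} (hc : c ∈ Ioo 0 cbar) :
    HasDerivAt H (h c) c :=
  (hH.deriv c (Ioo_subset_Icc_self hc)).hasDerivAt (Icc_mem_nhds hc.1 hc.2)

/-- Mean value theorem for a search-cost distribution. -/
theorem exists_density_mul_eq_sub (hH : IsCostD H h cbar) {a b : ℝ} (ha : 0 ≤ a) (hab : a < b)
    (hb : b ≤ cbar) : ∃ c ∈ Ioo a b, h c * (b - a) = H b - H a := by
  obtain ⟨c, hc, hslope⟩ := exists_hasDerivAt_eq_slope H h hab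
    (hH.smooth.continuousOn.mono (Icc_subset_Icc ha hb))
    fun x hx => hH.hasDerivAt ⟨ha.trans_lt hx.1, hx.2.trans_le hb⟩
  exact ⟨c, hc, by rw [hslope, div_mul_cancel₀ _ (sub_pos.2 hab).ne']⟩

/-- At an interior minimizer of the average density, the density equals the average density. -/
theorem density_eq_of_forall_mul_le (hH : IsCostD H h cbar) {m s : ℝ} (hm : m ∈ Ioo 0 cbar)
    (hs : H m = s * m) (hmin : ∀ c ∈ Icc 0 cbar, s * c ≤ H c) : h m = s := by
  have hloc : IsLocalMin (fun c => H c - s * c) m := by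
    filter_upwards [Icc_mem_nhds hm.1 hm.2] with c hc
    linarith [hmin c hc]
  have hderiv := hloc.hasDerivAt_eq_zero
    ((hH.hasDerivAt hm).sub ((hasDerivAt_id m).const_mul s))
  linarith

/-- Under a strictly increasing-then-decreasing density, no interior point minimizes the average
density. -/
theorem not_forall_mul_le (hH : IsCostD H h cbar) {p : ℝ}
    (hinc : StrictMonoOn h (Icc 0 p)) (hdec : StrictAntiOn h (Icc p cbar)) {m s : ℝ}
    (hm : m ∈ Ioo 0 cbar) (hs : H m = s * m) : ¬ ∀ c ∈ Icc 0 cbar, s * c ≤ H c := by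
  intro hmin
  have hhm := hH.density_eq_of_forall_mul_le hm hs hmin
  rcases le_or_gt m p with hmp | hpm
  · obtain ⟨c, hc, hmvt⟩ := hH.exists_density_mul_eq_sub le_rfl hm.1 hm.2.le
    have hlt : h c < h m := hinc ⟨hc.1.le, hc.2.le.trans hmp⟩ ⟨hm.1.le, hmp⟩ hc.2
    rw [hH.zero, hs] at hmvt
    nlinarith [hm.1]
  · obtain ⟨c, hc, hmvt⟩ := hH.exists_density_mul_eq_sub hm.1.le hm.2 le_rfl
    have hlt : h c < h m :=
      hdec ⟨hpm.le, hm.2.le⟩ ⟨(hpm.trans hc.1).le, hc.2.le⟩ hc.1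
    nlinarith [hm.2, hmin cbar (right_mem_Icc.2 hH.cbar_pos.le)]

end IsCostD

theorem Sfun_mul (H h : ℝ → ℝ) (h0 : H 0 = 0) (c : ℝ) : Sfun H h c * c = H c := by
  by_cases hc : c = 0
  · simp [hc, h0]
  · simp [Sfun, hc]

theorem sStar_eq_of_forall_le {H h : ℝ → ℝ} {cbar m : ℝ} (hm : m ∈ Icc 0 cbar)
    (hmin : ∀ c ∈ Icc 0 cbar, Sfun H h m ≤ Sfun H h c) : sStar H h cbar = Sfun H h m :=
  IsLeast.csInf_eq ⟨mem_image_of_mem _ hm, forall_mem_image.2 fun c hc => hmin c hc⟩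

/-- If H satisfies Assumption 1 and its density h is strictly increasing on
[0,p] and strictly decreasing on [p,c̄] for some interior p, then the global minimum of
S = H(c)/c on [0,c̄] is attained at c = 0: H(c) ≥ h(0)·c for all c ∈ [0,c̄], and
s*(H) = h(0). -/
theorem quasiconcave_density_min_average_density_at_zero
    (H h : ℝ → ℝ) (cbar : ℝ) (hH : IsCostD H h cbar)
    (hA : Assumption1 H h cbar)
    (p : ℝ) (hp : p ∈ Ioo (0:ℝ) cbar)
    (hinc : StrictMonoOn h (Icc 0 p)) (hdec : StrictAntiOn h (Icc p cbar)) :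
    (∀ c ∈ Icc (0:ℝ) cbar, h 0 * c ≤ H c) ∧ sStar H h cbar = h 0 := by
  obtain ⟨m, hm, hmin⟩ := hA
  have hmul : ∀ c ∈ Icc (0:ℝ) cbar, Sfun H h m * c ≤ H c := fun c hc => by
    rw [← Sfun_mul H h hH.zero c]
    exact mul_le_mul_of_nonneg_right (hmin c hc) hc.1
  obtain rfl | hm0 := hm.1.eq_or_lt
  · have hS : Sfun H h 0 = h 0 := if_pos rfl
    rw [← hS]
    exact ⟨hmul, sStar_eq_of_forall_le (Ico_subset_Icc_self hm) hmin⟩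
  · exact absurd hmul
      (hH.not_forall_mul_le hinc hdec ⟨hm0, hm.2⟩ (Sfun_mul H h hH.zero m).symm)

end CompSearch
end
end
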